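/- arXiv:1706.09616 — 2 statements merged into one kernel-verified Lean document; each statement's English description precedes it below -/
import Mathlib

section
/- Let L₁, L be real numbers with 0 < L₁ ≤ L/2, set α := L₁/L and suppose α is irrational; define ξ_n = 2|αn − ⌊αn + 1/2⌋|. Let (ω_n)_{n≥1} be a sequence of negative reals such that for every n ≥ 1 there exists k ∈ (1/√2, 1) with S(k) = L·√(−ω_n)/n and φ(k) = ξ_n. Then the sequence (√(−ω_n))_{n≥1} is unbounded; in particular (ω_n) is not bounded below. -/
open Real Filter Set

/-- Complete elliptic integral of the first kind. -/
noncomputable def Kell (k : ℝ) : ℝ :=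
  ∫ t in (0:ℝ)..1, 1 / Real.sqrt ((1 - t^2) * (1 - k^2 * t^2))

/-- S(k) = 4√(2k²−1)·K(k). -/
noncomputable def Sfun (k : ℝ) : ℝ := 4 * Real.sqrt (2 * k^2 - 1) * Kell k

/-- H(k), the numerator in the definition of φ. -/
noncomputable def Hfun (k : ℝ) : ℝ :=
  ∫ t in Real.sqrt ((2 * k^2 - 1) / k^2)..1,
    1 / Real.sqrt ((1 - t^2) * (1 - k^2 * (1 - t^2)))

/-- φ(k) = H(k)/K(k). -/
noncomputable def phiFun (k : ℝ) : ℝ := Hfun k / Kell k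

/-- ξ_n = 2|αn − ⌊αn + 1/2⌋|. -/
noncomputable def xiSeq (α : ℝ) (n : ℕ) : ℝ :=
  2 * |α * n - (⌊α * n + 1/2⌋ : ℝ)|

/-- The arcsine density is integrable on `[0, 1]`. -/
lemma intervalIntegrable_one_div_sqrt_one_sub_sq :
    IntervalIntegrable (fun t : ℝ => 1 / √(1 - t ^ 2)) MeasureTheory.volume 0 1 := by
  refine intervalIntegral.intervalIntegrable_deriv_of_nonneg (g := Real.arcsin)
    Real.continuous_arcsin.continuousOn ?_ ?_
  · intro x hx
    simp only [zero_le_one, inf_of_le_left, sup_of_le_right, mem_Ioo] at hx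
    exact Real.hasDerivAt_arcsin (by linarith) (by linarith)
  · intro x _
    positivity

lemma integral_one_div_sqrt_one_sub_sq :
    ∫ t in (0 : ℝ)..1, 1 / √(1 - t ^ 2) = π / 2 := by
  rw [intervalIntegral.integral_eq_sub_of_hasDerivAt_of_le zero_le_one
    Real.continuous_arcsin.continuousOn
    (fun x hx => Real.hasDerivAt_arcsin (by linarith [hx.1]) (by linarith [hx.2]))
    intervalIntegrable_one_div_sqrt_one_sub_sq]
  simp

/-- If `c ≤ g ≤ 1` with `0 < c`, then `1 / √((1 - t²) g)` is at most the scaled arcsine density. -/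
lemma one_div_sqrt_mul_le {t g c : ℝ} (hc : 0 < c) (hg : c ≤ g) :
    1 / √((1 - t ^ 2) * g) ≤ 1 / √c * (1 / √(1 - t ^ 2)) := by
  rw [Real.sqrt_mul' _ (hc.le.trans hg), one_div_mul_one_div, mul_comm (√c)]
  rcases (Real.sqrt_nonneg (1 - t ^ 2)).eq_or_lt with h | h
  · simp [← h]
  · have := Real.sqrt_pos.2 hc
    gcongr

lemma one_le_one_div_sqrt_mul {t g : ℝ} (ht : t ∈ Ioo (0 : ℝ) 1) (hg : 0 < g) (hg1 : g ≤ 1) :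
    1 ≤ 1 / √((1 - t ^ 2) * g) := by
  have h1 : 0 < 1 - t ^ 2 := by nlinarith [ht.1, ht.2]
  rw [le_div_iff₀ (Real.sqrt_pos.2 (mul_pos h1 hg)), one_mul, Real.sqrt_le_one]
  nlinarith [sq_nonneg t]

/-- Integrability of `1 / √((1 - t²) g t)` when `g` is bounded below by a positive constant. -/
lemma intervalIntegrable_one_div_sqrt_mul {g : ℝ → ℝ} {c : ℝ} (hgm : Measurable g) (hc : 0 < c)
    (hg : ∀ t ∈ Icc (0 : ℝ) 1, c ≤ g t) :
    IntervalIntegrable (fun t : ℝ => 1 / √((1 - t ^ 2) * g t)) MeasureTheory.volume 0 1 := by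
  refine (intervalIntegrable_one_div_sqrt_one_sub_sq.const_mul (1 / √c)).mono_fun
    (by
      have : Measurable fun t : ℝ => 1 / √((1 - t ^ 2) * g t) := by fun_prop
      exact this.aestronglyMeasurable) ?_
  filter_upwards [MeasureTheory.ae_restrict_mem measurableSet_uIoc] with t ht
  rw [uIoc_of_le zero_le_one] at ht
  rw [Real.norm_of_nonneg (by positivity), Real.norm_of_nonneg (by positivity)]
  exact one_div_sqrt_mul_le hc (hg t ⟨ht.1.le, ht.2⟩)

lemma intervalIntegrable_Kell {k : ℝ} (hk : k ^ 2 < 1) :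
    IntervalIntegrable (fun t : ℝ => 1 / √((1 - t ^ 2) * (1 - k ^ 2 * t ^ 2)))
      MeasureTheory.volume 0 1 :=
  intervalIntegrable_one_div_sqrt_mul (c := 1 - k ^ 2) (by fun_prop) (by linarith)
    fun t ht => by
      have : t ^ 2 ≤ 1 := pow_le_one₀ ht.1 ht.2
      nlinarith [sq_nonneg k]

lemma intervalIntegrable_Hfun {k : ℝ} (hk : k ^ 2 < 1) :
    IntervalIntegrable (fun t : ℝ => 1 / √((1 - t ^ 2) * (1 - k ^ 2 * (1 - t ^ 2))))
      MeasureTheory.volume 0 1 :=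
  intervalIntegrable_one_div_sqrt_mul (c := 1 - k ^ 2) (by fun_prop) (by linarith)
    fun t _ => by nlinarith [mul_nonneg (sq_nonneg k) (sq_nonneg t)]

lemma one_le_Kell {k : ℝ} (hk : k ^ 2 < 1) : 1 ≤ Kell k := by
  have h := intervalIntegral.integral_mono_on_of_le_Ioo zero_le_one
    (intervalIntegrable_const (c := (1 : ℝ))) (intervalIntegrable_Kell hk) fun t ht =>
      one_le_one_div_sqrt_mul ht
        (by
          have : t ^ 2 ≤ 1 := pow_le_one₀ ht.1.le ht.2.le
          nlinarith [sq_nonneg k])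
        (by nlinarith [mul_nonneg (sq_nonneg k) (sq_nonneg t)])
  simpa [Kell] using h

lemma Kell_le {k : ℝ} (hk : k ^ 2 < 1) : Kell k ≤ 1 / √(1 - k ^ 2) * (π / 2) := by
  rw [← integral_one_div_sqrt_one_sub_sq, ← intervalIntegral.integral_const_mul]
  refine intervalIntegral.integral_mono_on zero_le_one (intervalIntegrable_Kell hk)
    (intervalIntegrable_one_div_sqrt_one_sub_sq.const_mul _) fun t ht => ?_
  refine one_div_sqrt_mul_le (by linarith) ?_
  have : t ^ 2 ≤ 1 := pow_le_one₀ ht.1 ht.2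
  nlinarith [sq_nonneg k]

lemma one_sub_sqrt_le_Hfun {k : ℝ} (hk : k ^ 2 < 1) :
    1 - √((2 * k ^ 2 - 1) / k ^ 2) ≤ Hfun k := by
  have ha0 : 0 ≤ √((2 * k ^ 2 - 1) / k ^ 2) := Real.sqrt_nonneg _
  have ha1 : √((2 * k ^ 2 - 1) / k ^ 2) ≤ 1 := by
    rw [Real.sqrt_le_one]
    exact div_le_one_of_le₀ (by linarith) (sq_nonneg k)
  have h := intervalIntegral.integral_mono_on_of_le_Ioo ha1
    (intervalIntegrable_const (c := (1 : ℝ)))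
    ((intervalIntegrable_Hfun hk).mono_set (by
      rw [uIcc_of_le ha1, uIcc_of_le zero_le_one]
      exact Icc_subset_Icc_left ha0)) fun t ht =>
      one_le_one_div_sqrt_mul ⟨ha0.trans_lt ht.1, ht.2⟩
        (by nlinarith [mul_nonneg (sq_nonneg k) (sq_nonneg t)])
        (by
          have : t ^ 2 ≤ 1 := pow_le_one₀ (ha0.trans ht.1.le) ht.2.le
          nlinarith [mul_nonneg (sq_nonneg k) (sub_nonneg.2 this)])
  simpa [Hfun] using h

/-- Small values of `S` force `φ` away from `0`. -/
lemma one_div_eight_le_phiFun {k : ℝ} (hk : k ∈ Ioo (1 / √2) 1) (hS : Sfun k < 1) :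
    1 / 8 ≤ phiFun k := by
  have hk0 : 0 < k := lt_trans (by positivity) hk.1
  have hk1 : k ^ 2 < 1 := pow_lt_one₀ hk0.le hk.2 two_ne_zero
  have hk2 : 1 / 2 < k ^ 2 := by
    have := pow_lt_pow_left₀ hk.1 (by positivity) two_ne_zero
    rwa [div_pow, Real.sq_sqrt zero_le_two, one_pow] at this
  have hK := one_le_Kell hk1
  have hs : √(2 * k ^ 2 - 1) < 1 / 4 := by
    unfold Sfun at hS
    nlinarith [Real.sqrt_nonneg (2 * k ^ 2 - 1)]
  have hs2 : 2 * k ^ 2 - 1 < 1 / 16 := by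
    have := (Real.sqrt_lt' (by norm_num)).1 hs
    norm_num at this
    linarith
  have hH : 1 / 2 ≤ Hfun k := by
    have : √((2 * k ^ 2 - 1) / k ^ 2) ≤ 1 / 2 := by
      rw [Real.sqrt_le_left (by norm_num), div_le_iff₀ (by positivity)]
      linarith
    linarith [one_sub_sqrt_le_Hfun hk1]
  have hK4 : Kell k ≤ 4 := by
    have h1 : 1 / 2 ≤ √(1 - k ^ 2) := Real.le_sqrt_of_sq_le (by linarith)
    have h2 : 1 / √(1 - k ^ 2) ≤ 2 := by
      rw [div_le_iff₀ (by linarith)]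
      linarith
    calc Kell k ≤ 1 / √(1 - k ^ 2) * (π / 2) := Kell_le hk1
      _ ≤ 2 * (π / 2) := by gcongr
      _ ≤ 4 := by linarith [Real.pi_le_four]
  rw [phiFun, le_div_iff₀ (by linarith)]
  linarith

/-- Arbitrarily far out, `ξ_n` is small (Dirichlet approximation). -/
lemma exists_ge_xiSeq_lt (α : ℝ) {N : ℕ} : ∃ n, N ≤ n ∧ xiSeq α n < 1 / 8 := by
  obtain ⟨j, hj, -, h⟩ := Real.exists_nat_abs_mul_sub_round_le (α * N) (n := 31) (by norm_num)
  refine ⟨j * N, Nat.le_mul_of_pos_left N hj, ?_⟩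
  have hr : α * ((j * N : ℕ) : ℝ) = j * (α * N) := by push_cast; ring
  rw [xiSeq, hr, ← round_eq]
  norm_num at h
  linarith

/-- with α = L₁/L irrational, the frequencies ω_n determined by
S(k) = L√(−ω_n)/n, φ(k) = ξ_n give an unbounded sequence √(−ω_n); in
particular (ω_n) is not bounded below. -/
theorem stmt_8 (L₁ L α : ℝ) (hL₁ : 0 < L₁) (hL : L₁ ≤ L / 2)
    (hα : α = L₁ / L) (hirr : Irrational α)
    (ω : ℕ → ℝ) (hω : ∀ n : ℕ, 1 ≤ n → ω n < 0)
    (hk : ∀ n : ℕ, 1 ≤ n → ∃ k ∈ Set.Ioo (1 / Real.sqrt 2) 1,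
      Sfun k = L * Real.sqrt (-(ω n)) / n ∧ phiFun k = xiSeq α n) :
    (∀ M : ℝ, ∃ n : ℕ, 1 ≤ n ∧ M < Real.sqrt (-(ω n))) ∧
    (∀ M : ℝ, ∃ n : ℕ, 1 ≤ n ∧ ω n < M) := by
  have hLpos : 0 < L := by linarith
  have key : ∀ M : ℝ, ∃ n : ℕ, 1 ≤ n ∧ M < √(-(ω n)) := by
    intro M
    obtain ⟨N, hN⟩ := exists_nat_gt (L * M)
    obtain ⟨n, hn, hξ⟩ := exists_ge_xiSeq_lt α (N := N + 1)
    have hn1 : 1 ≤ n := by omega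
    refine ⟨n, hn1, ?_⟩
    by_contra! hM
    obtain ⟨k, hkI, hS, hφ⟩ := hk n hn1
    have hnN : (N : ℝ) ≤ n := by exact_mod_cast (by omega : N ≤ n)
    have hn0 : (0 : ℝ) < n := by exact_mod_cast hn1
    have hS1 : Sfun k < 1 := by
      rw [hS, div_lt_one hn0]
      nlinarith
    linarith [one_div_eight_le_phiFun hkI hS1]
  refine ⟨key, fun M => ?_⟩
  obtain ⟨n, hn, h⟩ := key (√(-M))
  exact ⟨n, hn, neg_lt_neg_iff.1 (lt_of_not_ge fun hle => h.not_ge (Real.sqrt_le_sqrt hle))⟩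
end

section
/- As k → (1/√2)⁺, the ratio S(k)/(1 − φ(k)) converges to 2·K(1/√2)², where K(1/√2) = ∫₀¹ dt/√((1−t²)(1−t²/2)). -/
open Real Filter Set

theorem sin_image_Ioo : Real.sin '' Set.Ioo 0 (π / 2) = Set.Ioo 0 1 := by
  ext y
  constructor
  · rintro ⟨x, ⟨h0, h1⟩, rfl⟩
    refine ⟨Real.sin_pos_of_pos_of_lt_pi h0 (by linarith [Real.pi_pos]), ?_⟩
    have := Real.sin_lt_sin_of_lt_of_le_pi_div_two (by linarith) le_rfl h1
    rwa [Real.sin_pi_div_two] at this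
  · rintro ⟨h0, h1⟩
    exact ⟨Real.arcsin y, ⟨Real.arcsin_pos.2 h0, Real.arcsin_lt_pi_div_two.2 h1⟩,
      Real.sin_arcsin (by linarith) h1.le⟩

theorem cos_image_Ioo : Real.cos '' Set.Ioo 0 (π / 2) = Set.Ioo 0 1 := by
  ext y
  constructor
  · rintro ⟨x, ⟨h0, h1⟩, rfl⟩
    refine ⟨Real.cos_pos_of_mem_Ioo ⟨by linarith, h1⟩, ?_⟩
    have := Real.cos_lt_cos_of_nonneg_of_le_pi_div_two le_rfl h1.le h0
    rwa [Real.cos_zero] at this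
  · rintro ⟨h0, h1⟩
    exact ⟨Real.arccos y, ⟨Real.arccos_pos.2 h1, Real.arccos_lt_pi_div_two.2 h0⟩,
      Real.cos_arccos (by linarith) h1.le⟩

/-- The integrand of the trigonometric form of the complete elliptic integral. -/
noncomputable def trigIntegrand (k θ : ℝ) : ℝ := 1 / Real.sqrt (1 - k ^ 2 * Real.sin θ ^ 2)

/-- The integrand of `Hfun`. -/
noncomputable def cosIntegrand (k t : ℝ) : ℝ :=
  1 / Real.sqrt ((1 - t ^ 2) * (1 - k ^ 2 * (1 - t ^ 2)))

theorem mul_one_div_sqrt_sq_mul {a b : ℝ} (ha : 0 < a) :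
    a * (1 / Real.sqrt (a ^ 2 * b)) = 1 / Real.sqrt b := by
  rw [Real.sqrt_mul (sq_nonneg a), Real.sqrt_sq ha.le]
  field_simp

theorem Kell_eq_trig (k : ℝ) : Kell k = ∫ θ in (0 : ℝ)..(π / 2), trigIntegrand k θ := by
  have h := MeasureTheory.integral_image_eq_integral_abs_deriv_smul
    (s := Set.Ioo 0 (π / 2)) measurableSet_Ioo
    (fun x _ => (Real.hasDerivAt_sin x).hasDerivWithinAt)
    (Real.injOn_sin.mono
      (Set.Ioo_subset_Icc_self.trans (Set.Icc_subset_Icc_left (by linarith [Real.pi_pos]))))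
    (fun t => 1 / Real.sqrt ((1 - t ^ 2) * (1 - k ^ 2 * t ^ 2)))
  rw [sin_image_Ioo] at h
  rw [Kell, intervalIntegral.integral_of_le zero_le_one,
    intervalIntegral.integral_of_le (by positivity), MeasureTheory.integral_Ioc_eq_integral_Ioo,
    MeasureTheory.integral_Ioc_eq_integral_Ioo, h]
  refine MeasureTheory.setIntegral_congr_fun measurableSet_Ioo fun θ hθ => ?_
  have hc : 0 < Real.cos θ := Real.cos_pos_of_mem_Ioo ⟨by linarith [hθ.1, Real.pi_pos], hθ.2⟩
  simp only [smul_eq_mul, abs_of_pos hc, trigIntegrand]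
  rw [← Real.cos_sq', mul_one_div_sqrt_sq_mul hc]

theorem abs_neg_sin_smul_cosIntegrand (k : ℝ) {θ : ℝ} (hθ : θ ∈ Set.Ioo 0 (π / 2)) :
    |-Real.sin θ| • cosIntegrand k (Real.cos θ) = trigIntegrand k θ := by
  have hs : 0 < Real.sin θ :=
    Real.sin_pos_of_pos_of_lt_pi hθ.1 (by linarith [hθ.2, Real.pi_pos])
  simp only [smul_eq_mul, abs_neg, abs_of_pos hs, trigIntegrand, cosIntegrand]
  rw [← Real.sin_sq, mul_one_div_sqrt_sq_mul hs]

theorem injOn_cos_Ioo : Set.InjOn Real.cos (Set.Ioo 0 (π / 2)) :=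
  Real.injOn_cos.mono
    (Set.Ioo_subset_Icc_self.trans (Set.Icc_subset_Icc_right (by linarith [Real.pi_pos])))

theorem Kell_eq_integral_cosIntegrand (k : ℝ) :
    Kell k = ∫ t in (0 : ℝ)..1, cosIntegrand k t := by
  have h := MeasureTheory.integral_image_eq_integral_abs_deriv_smul
    (s := Set.Ioo 0 (π / 2)) measurableSet_Ioo
    (fun x _ => (Real.hasDerivAt_cos x).hasDerivWithinAt) injOn_cos_Ioo (cosIntegrand k)
  rw [cos_image_Ioo] at h
  rw [Kell_eq_trig, intervalIntegral.integral_of_le zero_le_one,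
    intervalIntegral.integral_of_le (by positivity), MeasureTheory.integral_Ioc_eq_integral_Ioo,
    MeasureTheory.integral_Ioc_eq_integral_Ioo, h]
  exact MeasureTheory.setIntegral_congr_fun measurableSet_Ioo fun θ hθ =>
    (abs_neg_sin_smul_cosIntegrand k hθ).symm

theorem one_sub_sq_mul_sin_sq_pos {k : ℝ} (hk : k ^ 2 < 1) (θ : ℝ) :
    0 < 1 - k ^ 2 * Real.sin θ ^ 2 := by
  nlinarith [Real.sin_sq_le_one θ, sq_nonneg k, sq_nonneg (Real.sin θ)]

theorem continuous_trigIntegrand {k : ℝ} (hk : k ^ 2 < 1) : Continuous (trigIntegrand k) := by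
  unfold trigIntegrand
  exact continuous_const.div (by fun_prop)
    fun θ => (Real.sqrt_pos.2 (one_sub_sq_mul_sin_sq_pos hk θ)).ne'

theorem Kell_pos {k : ℝ} (hk : k ^ 2 < 1) : 0 < Kell k := by
  rw [Kell_eq_trig]
  refine intervalIntegral.intervalIntegral_pos_of_pos
    ((continuous_trigIntegrand hk).intervalIntegrable _ _) (fun θ => ?_) (by positivity)
  exact one_div_pos.2 (Real.sqrt_pos.2 (one_sub_sq_mul_sin_sq_pos hk θ))

theorem intervalIntegrable_cosIntegrand {k : ℝ} (hk : k ^ 2 < 1) :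
    IntervalIntegrable (cosIntegrand k) MeasureTheory.volume 0 1 := by
  rw [intervalIntegrable_iff_integrableOn_Ioo_of_le zero_le_one, ← cos_image_Ioo,
    MeasureTheory.integrableOn_image_iff_integrableOn_abs_deriv_smul measurableSet_Ioo
    (fun x _ => (Real.hasDerivAt_cos x).hasDerivWithinAt) injOn_cos_Ioo,
    MeasureTheory.integrableOn_congr_fun
      (fun θ hθ => abs_neg_sin_smul_cosIntegrand k hθ) measurableSet_Ioo,
    ← intervalIntegrable_iff_integrableOn_Ioo_of_le (by positivity)]
  exact (continuous_trigIntegrand hk).intervalIntegrable _ _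

theorem tendsto_Kell_of_sq_lt {k₀ : ℝ} (hk₀ : k₀ ^ 2 < 3 / 4) :
    Tendsto Kell (nhds k₀) (nhds (Kell k₀)) := by
  have hc : Continuous fun k : ℝ => ∫ θ in (0 : ℝ)..(π / 2),
      1 / Real.sqrt (max (1 - k ^ 2 * Real.sin θ ^ 2) (1 / 4)) := by
    refine intervalIntegral.continuous_parametric_intervalIntegral_of_continuous' ?_ _ _
    refine continuous_const.div (by fun_prop) fun p => (Real.sqrt_pos.2 ?_).ne'
    exact lt_max_of_lt_right (by norm_num)
  have heq : ∀ k : ℝ, k ^ 2 < 3 / 4 → ∫ θ in (0 : ℝ)..(π / 2),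
      1 / Real.sqrt (max (1 - k ^ 2 * Real.sin θ ^ 2) (1 / 4)) = Kell k := by
    intro k hk
    rw [Kell_eq_trig]
    refine intervalIntegral.integral_congr fun θ _ => ?_
    simp only [trigIntegrand]
    rw [max_eq_left]
    nlinarith [Real.sin_sq_le_one θ, sq_nonneg k, sq_nonneg (Real.sin θ)]
  have ht := hc.tendsto k₀
  rw [heq k₀ hk₀] at ht
  refine ht.congr' ?_
  have hev : ∀ᶠ k : ℝ in nhds k₀, k ^ 2 < 3 / 4 :=
    (continuous_pow 2).continuousAt.eventually_lt continuousAt_const hk₀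
  filter_upwards [hev] with k hk using heq k hk

/-- The integral of `cosIntegrand k` over `[0, s]`, rescaled to the unit interval. -/
noncomputable def scaledIntegral (k s : ℝ) : ℝ := ∫ u in (0 : ℝ)..1, cosIntegrand k (s * u)

theorem tendsto_scaledIntegral {k₀ : ℝ} (hk₀ : k₀ ^ 2 < 3 / 4) :
    Tendsto (fun p : ℝ × ℝ => scaledIntegral p.1 p.2) (nhds (k₀, 0))
      (nhds (1 / Real.sqrt (1 - k₀ ^ 2))) := by
  have hc : Continuous fun p : ℝ × ℝ => ∫ u in (0 : ℝ)..1,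
      1 / Real.sqrt (max ((1 - (p.2 * u) ^ 2) * (1 - p.1 ^ 2 * (1 - (p.2 * u) ^ 2))) (1 / 8)) := by
    refine intervalIntegral.continuous_parametric_intervalIntegral_of_continuous' ?_ _ _
    refine continuous_const.div (by fun_prop) fun p => (Real.sqrt_pos.2 ?_).ne'
    exact lt_max_of_lt_right (by norm_num)
  have ht := hc.tendsto (k₀, 0)
  have hval : max (1 - k₀ ^ 2) (1 / 8) = 1 - k₀ ^ 2 := max_eq_left (by linarith)
  simp only [zero_mul, ne_eq, OfNat.ofNat_ne_zero, not_false_eq_true, zero_pow, sub_zero, mul_one,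
    one_mul, hval, intervalIntegral.integral_const, one_smul] at ht
  refine ht.congr' ?_
  have hev : ∀ᶠ p : ℝ × ℝ in nhds (k₀, 0), p.1 ^ 2 < 3 / 4 :=
    (continuous_fst.pow 2).continuousAt.eventually_lt continuousAt_const hk₀
  have hev' : ∀ᶠ p : ℝ × ℝ in nhds (k₀, 0), p.2 ^ 2 < 1 / 2 :=
    (continuous_snd.pow 2).continuousAt.eventually_lt continuousAt_const (by norm_num)
  filter_upwards [hev, hev'] with p hp hp'
  refine intervalIntegral.integral_congr fun u hu => ?_
  rw [Set.uIcc_of_le zero_le_one] at hu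
  simp only [cosIntegrand]
  rw [max_eq_left]
  have hu2 : u ^ 2 ≤ 1 := pow_le_one₀ hu.1 hu.2
  have hx : (p.2 * u) ^ 2 ≤ 1 / 2 := by
    rw [mul_pow]
    nlinarith [sq_nonneg p.2, sq_nonneg u]
  have hx0 := sq_nonneg (p.2 * u)
  have h1 : 1 / 4 ≤ 1 - p.1 ^ 2 * (1 - (p.2 * u) ^ 2) := by
    nlinarith [mul_nonneg (sq_nonneg p.1) hx0]
  nlinarith

theorem Kell_sub_integral_cosIntegrand {k s : ℝ} (hk : k ^ 2 < 1) (hs : s ∈ Set.Icc (0 : ℝ) 1) :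
    Kell k - ∫ t in s..1, cosIntegrand k t = s * scaledIntegral k s := by
  have hi := intervalIntegrable_cosIntegrand hk
  have h1 : IntervalIntegrable (cosIntegrand k) MeasureTheory.volume 0 s :=
    hi.mono_set (Set.uIcc_subset_uIcc_left (by rwa [Set.uIcc_of_le zero_le_one]))
  have h2 : IntervalIntegrable (cosIntegrand k) MeasureTheory.volume s 1 :=
    hi.mono_set (Set.uIcc_subset_uIcc_right (by rwa [Set.uIcc_of_le zero_le_one]))
  rw [Kell_eq_integral_cosIntegrand, ← intervalIntegral.integral_add_adjacent_intervals h1 h2,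
    scaledIntegral, intervalIntegral.mul_integral_comp_mul_left]
  simp

theorem Sfun_div_one_sub_phiFun {k : ℝ} (hk : 1 / Real.sqrt 2 < k) (hk1 : k < 1) :
    Sfun k / (1 - phiFun k) =
      4 * k * Kell k ^ 2 / scaledIntegral k (Real.sqrt ((2 * k ^ 2 - 1) / k ^ 2)) := by
  have hk0 : 0 < k := lt_trans (by positivity) hk
  have hsq : k ^ 2 < 1 := by nlinarith
  have hr : 0 < 2 * k ^ 2 - 1 := by
    have := pow_lt_pow_left₀ hk (by positivity) two_ne_zero
    rw [div_pow, Real.sq_sqrt zero_le_two] at this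
    linarith
  have hK := Kell_pos hsq
  set s := Real.sqrt ((2 * k ^ 2 - 1) / k ^ 2) with hs
  have hs' : s = Real.sqrt (2 * k ^ 2 - 1) / k := by
    rw [hs, Real.sqrt_div hr.le, Real.sqrt_sq hk0.le]
  have hs1 : s ≤ 1 := by
    rw [hs, Real.sqrt_le_one, div_le_one (by positivity)]
    linarith
  have hH : Kell k - Hfun k = s * scaledIntegral k s :=
    Kell_sub_integral_cosIntegrand hsq ⟨Real.sqrt_nonneg _, hs1⟩
  have hphi : 1 - phiFun k = s * scaledIntegral k s / Kell k := by
    rw [← hH, phiFun, sub_div, div_self hK.ne']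
  have hrt : 0 < Real.sqrt (2 * k ^ 2 - 1) := Real.sqrt_pos.2 hr
  rw [hphi, Sfun]
  generalize scaledIntegral k s = I
  rw [hs']
  rcases eq_or_ne I 0 with rfl | hI
  · simp
  · field_simp

/-- S(k)/(1 − φ(k)) → 2·K(1/√2)² as k → (1/√2)⁺. -/
theorem stmt_10 :
    Filter.Tendsto (fun k => Sfun k / (1 - phiFun k))
      (nhdsWithin (1 / Real.sqrt 2) (Set.Ioo (1 / Real.sqrt 2) 1))
      (nhds (2 * Kell (1 / Real.sqrt 2) ^ 2)) := by
  set k₀ : ℝ := 1 / Real.sqrt 2 with hk₀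
  have hpos : 0 < k₀ := by positivity
  have hsq : k₀ ^ 2 = 1 / 2 := by
    rw [hk₀, div_pow, Real.sq_sqrt zero_le_two, one_pow]
  have hlt : k₀ ^ 2 < 3 / 4 := by rw [hsq]; norm_num
  have hs : Tendsto (fun k : ℝ => Real.sqrt ((2 * k ^ 2 - 1) / k ^ 2)) (nhds k₀) (nhds 0) := by
    have hc : ContinuousAt (fun k : ℝ => Real.sqrt ((2 * k ^ 2 - 1) / k ^ 2)) k₀ :=
      (ContinuousAt.div (by fun_prop) (by fun_prop) (by positivity)).sqrt
    have := hc.tendsto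
    simpa [hsq] using this
  have hI : Tendsto (fun k : ℝ => scaledIntegral k (Real.sqrt ((2 * k ^ 2 - 1) / k ^ 2)))
      (nhds k₀) (nhds (1 / k₀)) := by
    have := (tendsto_scaledIntegral hlt).comp
      ((tendsto_id (α := ℝ) (x := nhds k₀)).prodMk_nhds hs)
    have hv : Real.sqrt (1 - k₀ ^ 2) = k₀ := by
      rw [show 1 - k₀ ^ 2 = k₀ ^ 2 by rw [hsq]; norm_num, Real.sqrt_sq hpos.le]
    rwa [hv] at this
  have hmain : Tendsto (fun k : ℝ => 4 * k * Kell k ^ 2 /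
      scaledIntegral k (Real.sqrt ((2 * k ^ 2 - 1) / k ^ 2))) (nhds k₀)
      (nhds (4 * k₀ * Kell k₀ ^ 2 / (1 / k₀))) :=
    ((tendsto_const_nhds.mul tendsto_id).mul ((tendsto_Kell_of_sq_lt hlt).pow 2)).div hI
      (by positivity)
  have hlim : 4 * k₀ * Kell k₀ ^ 2 / (1 / k₀) = 2 * Kell k₀ ^ 2 := by
    rw [div_div_eq_mul_div, div_one]
    linear_combination 4 * Kell k₀ ^ 2 * hsq
  rw [hlim] at hmain
  refine (hmain.mono_left nhdsWithin_le_nhds).congr' ?_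
  filter_upwards [self_mem_nhdsWithin] with k hk
  exact (Sfun_div_one_sub_phiFun hk.1 hk.2).symm
end
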